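/- There exists a set of 41 points in the plane in general position that contains no 9-crossing family. -/

import Mathlib

/-- A finite set of points in the plane is in *general position* if no three of
its points are collinear. -/
def GenPos (S : Finset (ℝ × ℝ)) : Prop :=
  ∀ p ∈ S, ∀ q ∈ S, ∀ r ∈ S, p ≠ q → p ≠ r → q ≠ r →
    ¬Collinear ℝ ({p, q, r} : Set (ℝ × ℝ))

/-- Two closed segments `pq` and `rs` *cross* if they intersect in exactly one
point, which lies in the interior of both segments. -/
def Crosses (p q r s : ℝ × ℝ) : Prop :=
  ∃ x : ℝ × ℝ, x ∈ openSegment ℝ p q ∧ x ∈ openSegment ℝ r s ∧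
    segment ℝ p q ∩ segment ℝ r s = {x}

/-- `F` is a *crossing family* in `S`: a finite set of segments (given by their
pairs of distinct endpoints, which belong to `S`) that pairwise cross. -/
def IsCrossingFamily (S : Finset (ℝ × ℝ)) (F : Finset ((ℝ × ℝ) × (ℝ × ℝ))) : Prop :=
  (∀ e ∈ F, e.1 ∈ S ∧ e.2 ∈ S ∧ e.1 ≠ e.2) ∧
  (∀ e ∈ F, ∀ f ∈ F, e ≠ f → Crosses e.1 e.2 f.1 f.2)

/-- `S` contains a `k`-crossing family. -/
def HasCrossingFamily (S : Finset (ℝ × ℝ)) (k : ℕ) : Prop :=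
  ∃ F : Finset ((ℝ × ℝ) × (ℝ × ℝ)), IsCrossingFamily S F ∧ F.card = k

/-- `cf S`: the maximum size of a crossing family in `S`. -/
noncomputable def cf (S : Finset (ℝ × ℝ)) : ℕ :=
  sSup {k : ℕ | HasCrossingFamily S k}

/-- `cfNat n`: the minimum of `cf S` over all sets `S` of `n` points in
general position. -/
noncomputable def cfNat (n : ℕ) : ℕ :=
  sInf {m : ℕ | ∃ S : Finset (ℝ × ℝ), S.card = n ∧ GenPos S ∧ cf S = m}

namespace CrossingSearch

/-! ### The point set -/

/-- Forty-one points with natural coordinates. -/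
def points : List (ℕ × ℕ) :=
  [(5899, 7715), (5846, 8851), (5921, 7753), (5837, 7621), (5721, 8277), (5690, 9851),
   (5822, 9081), (5684, 9733), (9703, 4056), (9027, 4032), (9916, 4045), (8876, 4037),
   (8242, 3924), (7629, 3819), (7625, 3822), (7616, 3837), (1082, 1160), (654, 654),
   (0, 0), (1463, 1555), (1387, 1420), (1826, 2003), (1834, 2006), (1864, 2024),
   (5237, 4470), (4138, 4068), (4803, 4809), (4978, 4506), (4402, 3681), (4476, 4224),
   (4812, 4018), (4966, 5166), (5441, 5210), (5705, 4869), (5455, 4300), (5253, 5243),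
   (5637, 4065), (5674, 4487), (5924, 4670), (4466, 4011), (5633, 5578)]

/-- The `i`-th point (junk for `41 ≤ i`). -/
def point (i : ℕ) : ℕ × ℕ := points.getD i (0, 0)

/-- Whether the triangle `p q r` is positively oriented. -/
def isLeft (p q r : ℕ × ℕ) : Bool :=
  Nat.ble (Nat.succ (((p.2.mul q.1).add (q.2.mul r.1)).add (r.2.mul p.1)))
    (((p.1.mul q.2).add (q.1.mul r.2)).add (r.1.mul p.2))

/-! ### An exhaustive search for crossing families

The segment joining the points `k` and `l` with `l < k` is encoded as the number `64 * k + l`, and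
a set of segments as the number whose binary digits are its indicator function; digits with index
below `64` encode no segment. The functions below are meant to be evaluated by the kernel, so they
are written with recursors and with the operations on natural numbers that the kernel computes
natively. -/

/-- `force n k` is `k n`; the kernel evaluates `n` to a literal first. -/
def force {α : Type} (n : ℕ) (k : ℕ → α) : α :=
  Nat.rec (motive := fun _ => α) (k (nat_lit 0)) (fun m _ => k (Nat.succ m)) n

/-- The bitwise disjunction of the numbers `f a <<< (w * a)` for `a < n`. -/
def pack (w : ℕ) (f : ℕ → ℕ) (n : ℕ) : ℕ :=
  Nat.rec (motive := fun _ => ℕ) (nat_lit 0)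
    (fun a ih => Nat.lor ih (Nat.shiftLeft (f a) (Nat.mul w a))) n

/-- The set of indices in `l` of points to the left of the line from `p` to `q`. -/
def leftMask (p q : ℕ × ℕ) (l : List (ℕ × ℕ)) : ℕ :=
  List.rec (motive := fun _ => ℕ) (nat_lit 0)
    (fun r _ ih => Bool.rec (Nat.mul (nat_lit 2) ih) (Nat.succ (Nat.mul (nat_lit 2) ih))
      (isLeft p q r)) l

/-- All the orientations of triples of points, packed into one number. -/
def leftTable : ℕ :=
  pack (nat_lit 4096) (fun i => pack (nat_lit 64)
    (fun j => leftMask (point i) (point j) points) (nat_lit 41)) (nat_lit 41)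

/-- The set of points to the left of the line from point `i` to point `j`, read off a table. -/
def getLeft (L i j : ℕ) : ℕ :=
  Nat.land (Nat.shiftRight L (Nat.add (Nat.mul (nat_lit 4096) i) (Nat.mul (nat_lit 64) j)))
    (nat_lit 18446744073709551615)

/-- The set of points `b < a` such that `a b` crosses `k l`, where `kl` and `lk` are the two sides
of the line through `k` and `l`. -/
def adjRow (L k l kl lk a : ℕ) : ℕ :=
  Nat.land (Nat.land (Nat.lor (Nat.land (getLeft L a k) (getLeft L l a))
    (Nat.land (getLeft L k a) (getLeft L a l))) (Bool.rec kl lk (Nat.testBit kl a)))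
    (Nat.pred (Nat.shiftLeft (nat_lit 1) a))

/-- Fills the unused lower digits of `x` with a fingerprint: the kernel hashes a literal by its last
64 digits. -/
def tag (x : ℕ) : ℕ := Nat.lor x (Nat.mod x (nat_lit 2305843009213693951))

/-- The set of segments with both ends before `k` that cross the segment `k l`. -/
def adjEntry (L k l : ℕ) : ℕ :=
  Bool.rec (nat_lit 0)
    (force (getLeft L k l) fun kl => force (getLeft L l k) fun lk =>
      tag (pack (nat_lit 64) (adjRow L k l kl lk) k))
    (Nat.ble (Nat.succ l) k)

/-- Binary trees with numbers at the leaves. -/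
inductive Table
  | leaf (n : ℕ) : Table
  | node (m : ℕ) (l r : Table) : Table

namespace Table

/-- The tree of depth `d` with leaves `f i, f (i + 1), …`. -/
def build (f : ℕ → ℕ) : ℕ → ℕ → Table
  | 0, i => leaf (f i)
  | d + 1, i => node (2 ^ 2 ^ d) (build f d i) (build f d (i + 2 ^ d))

/-- Passes the tree `build f d 0`, fully evaluated, to `k`. -/
def buildThen (f : ℕ → ℕ) (d : ℕ) (k : Table → Bool) : Bool :=
  Nat.rec (motive := fun _ => ℕ → (Table → Bool) → Bool)
    (fun i k => force (f i) fun n => k (leaf n))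
    (fun d ih i k => force (Nat.shiftLeft (nat_lit 1) d) fun m => ih i fun l =>
      force (Nat.add i m) fun j => ih j fun r =>
        force (Nat.shiftLeft (nat_lit 1) m) fun m => k (node m l r))
    d (nat_lit 0) k

/-- Whether `f` holds at the leaves indexed by the binary digits of `x`. -/
noncomputable def all (f : ℕ → Bool) (t : Table) (x : ℕ) : Bool :=
  Table.rec (motive := fun _ => ℕ → Bool) (fun n _ => f n)
    (fun m _ _ l r x =>
      force (Nat.div x m) fun x1 => Bool.rec
        (force (Nat.mod x m) fun x0 =>
          Bool.rec (Bool.rec false (l x0) (r x1)) (r x1) (Nat.beq x0 (nat_lit 0)))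
        (l x) (Nat.beq x1 (nat_lit 0))) t x

end Table

/-- The digits `64 * a` for `a < 41`. -/
def rowUnits : ℕ := pack (nat_lit 64) (fun _ => nat_lit 1) (nat_lit 41)

/-- The digits `64 * a + b` for `0 < a < 41` and `b < 63`. -/
def rowMask : ℕ :=
  Nat.shiftLeft (pack (nat_lit 64) (fun _ => nat_lit 9223372036854775807) (nat_lit 40)) (nat_lit 64)

/-- The digits `63 * a` for `a < 41`. -/
def diagonal : ℕ := pack (nat_lit 63) (fun _ => nat_lit 1) (nat_lit 41)

/-- The number of larger endpoints of segments in `P`. -/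
def countRows (H M P : ℕ) : ℕ :=
  Nat.mod (Nat.land (Nat.shiftRight (Nat.add (Nat.land P M) M) (nat_lit 63)) H)
    (nat_lit 18446744073709551615)

/-- The number of binary digits of `x`. -/
def countBits (H C x : ℕ) : ℕ :=
  Nat.mod (Nat.land (Nat.mul x C) H) (nat_lit 18446744073709551615)

/-- The set of smaller endpoints of segments in `P`. -/
def foldCols (P : ℕ) : ℕ :=
  List.rec (motive := fun _ => ℕ → ℕ)
    (fun P => Nat.land (Nat.shiftRight P (nat_lit 64)) (nat_lit 9223372036854775807))
    (fun s _ ih P => force (Nat.lor P (Nat.shiftRight P s)) ih)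
    [nat_lit 2048, nat_lit 1024, nat_lit 512, nat_lit 256, nat_lit 128, nat_lit 64] P

/-- Whether there are at least `r` larger and `r` smaller endpoints of segments in `P`. -/
def hasRoom (H M C r P : ℕ) : Bool :=
  Bool.rec false (Nat.ble r (countBits H C (foldCols P))) (Nat.ble r (countRows H M P))

/-- The crossing sets of the segments with larger endpoint `shift / 64`. -/
structure Row where
  shift : ℕ
  tbl : Table

/-- The rows below `n`, the largest first. -/
def rowList (L : ℕ) : ℕ → List Row
  | 0 => []
  | n + 1 => ⟨64 * n, Table.build (adjEntry L n) 6 0⟩ :: rowList L n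

/-- Passes `rowList L n`, fully evaluated, to `k`. -/
def rowListThen (L n : ℕ) (k : List Row → Bool) : Bool :=
  Nat.rec (motive := fun _ => (List Row → Bool) → Bool) (fun k => k [])
    (fun n ih k => ih fun rs => Table.buildThen (adjEntry L n) (nat_lit 6) fun t =>
      force (Nat.mul (nat_lit 64) n) fun s => k (⟨s, t⟩ :: rs)) n k

/-- If `search H M C rows r P` holds then `P` contains no `r` pairwise crossing segments. -/
noncomputable def search (H M C : ℕ) (rows : List Row) (r P : ℕ) : Bool :=
  List.rec (motive := fun _ => ℕ → ℕ → Bool)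
    (fun r _ => Bool.rec true false (Nat.beq r (nat_lit 0)))
    (fun row _ ih r P => Row.rec (fun s t => Nat.rec false (fun r' _ =>
      force (Nat.shiftRight P s) fun x => Bool.rec
        (Bool.rec false
          (force (Nat.mod P (Nat.shiftLeft (nat_lit 1) s)) fun P =>
            Bool.rec true (ih r P) (hasRoom H M C r P))
          (t.all (fun e => force (tag (Nat.land P e)) fun Q =>
            Bool.rec true (ih r' Q) (hasRoom H M C r' Q)) x))
        (ih r P) (Nat.beq x (nat_lit 0))) r) row) rows r P

/-- If `searchTop H M C rows r m` holds then there are no `r + 1` pairwise crossing segments whose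
largest endpoint is among the first `m` entries of `rows`. -/
noncomputable def searchTop (H M C : ℕ) (rows : List Row) (r m : ℕ) : Bool :=
  List.rec (motive := fun _ => ℕ → Bool) (fun _ => true)
    (fun row rest ih m => Row.rec (fun s t => Nat.rec true (fun m' _ =>
      Bool.rec false (ih m')
        (t.all (fun e => Bool.rec true (search H M C rest r e) (hasRoom H M C r e))
          (Nat.pred (Nat.shiftLeft (nat_lit 1) (Nat.div s (nat_lit 64)))))) m) row) rows m

/-- The search for nine pairwise crossing segments with largest endpoint in `[n - m, n)`. -/
noncomputable def noFamily (n m : ℕ) : Bool :=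
  force leftTable fun L => rowListThen L n fun rows =>
    force rowUnits fun H => force rowMask fun M => force diagonal fun C =>
      searchTop H M C rows (nat_lit 8) m

/-! ### Bit operations -/

theorem force_eq {α : Type} (n : ℕ) (k : ℕ → α) : force n k = k n := by
  cases n <;> rfl

theorem pack_succ (w : ℕ) (f : ℕ → ℕ) (n : ℕ) :
    pack w f (n + 1) = pack w f n ||| f n <<< (w * n) := rfl

theorem pack_lt {w : ℕ} {f : ℕ → ℕ} {n : ℕ} (hf : ∀ a < n, f a < 2 ^ w) :
    pack w f n < 2 ^ (w * n) := by
  induction n with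
  | zero => exact Nat.two_pow_pos _
  | succ n ih =>
    rw [pack_succ]
    refine Nat.or_lt_two_pow ((ih fun a ha => hf a (by omega)).trans_le
      (Nat.pow_le_pow_right (by omega) (by gcongr; omega))) ?_
    rw [Nat.shiftLeft_eq, Nat.mul_succ, Nat.pow_add, mul_comm]
    exact Nat.mul_lt_mul_of_pos_left (hf n (by omega)) (Nat.two_pow_pos _)

theorem testBit_pack {w : ℕ} {f : ℕ → ℕ} {n a b : ℕ} (hf : ∀ a < n, f a < 2 ^ w) (ha : a < n)
    (hb : b < w) : (pack w f n).testBit (w * a + b) = (f a).testBit b := by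
  induction n with
  | zero => omega
  | succ n ih =>
    rw [pack_succ, Nat.testBit_or, Nat.testBit_shiftLeft]
    rcases Nat.lt_succ_iff_lt_or_eq.mp ha with h | rfl
    · have : w * (a + 1) ≤ w * n := Nat.mul_le_mul_left _ h
      rw [ih (fun a ha => hf a (by omega)) h]
      simp only [ge_iff_le, Bool.or_eq_left_iff_imp, Bool.and_eq_true, decide_eq_true_eq]
      rw [Nat.mul_succ] at this
      omega
    · rw [Nat.testBit_lt_two_pow ((pack_lt fun a ha => hf a (by omega)).trans_le
        (Nat.pow_le_pow_right (by omega) (by omega)))]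
      simp

theorem testBit_pack_of_lt {w : ℕ} {f : ℕ → ℕ} {n a b : ℕ} (ha : a < n)
    (hb : (f a).testBit b) : (pack w f n).testBit (w * a + b) := by
  induction n with
  | zero => omega
  | succ n ih =>
    rw [pack_succ, Nat.testBit_or, Nat.testBit_shiftLeft]
    rcases Nat.lt_succ_iff_lt_or_eq.mp ha with h | rfl
    · simp [ih h]
    · simp [hb]

theorem testBit_tag {x i : ℕ} (h : x.testBit i) : (tag x).testBit i := by
  change (x ||| _).testBit i = true
  simp [h]

/-- Counting the digits of `Y` at multiples of `64` by casting out `2 ^ 64 - 1`. -/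
theorem card_le_mod {Y : ℕ} {T : Finset ℕ} (hT : ∀ k ∈ T, k < 41 ∧ Y.testBit (64 * k)) :
    T.card ≤ (Y &&& rowUnits) % (2 ^ 64 - 1) := by
  have key : ∀ n, (Y &&& pack 64 (fun _ => 1) n) ≡
      ((Finset.range n).filter fun k => Y.testBit (64 * k)).card [MOD 2 ^ 64 - 1] := by
    intro n
    induction n with
    | zero => simp [pack, Nat.ModEq]
    | succ n ih =>
      have hlt : Y &&& pack 64 (fun _ => 1) n < 2 ^ (64 * n) :=
        Nat.and_lt_two_pow _ (pack_lt fun _ _ => by norm_num)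
      rw [pack_succ, Nat.and_or_distrib_left, Nat.shiftLeft_eq, one_mul, Nat.and_two_pow,
        Finset.range_add_one, Finset.filter_insert]
      cases hY : Y.testBit (64 * n)
      · simpa using ih
      · rw [Bool.toNat_true, Nat.or_comm, ← mul_one (2 ^ (64 * n)), one_mul,
          ← Nat.two_pow_add_eq_or_of_lt hlt, mul_one]
        simp only [if_true]
        rw [Finset.card_insert_of_notMem (by simp), add_comm]
        refine ih.add ?_
        rw [pow_mul]
        simpa using (show (2 ^ 64 ≡ 1 [MOD 2 ^ 64 - 1]) by decide).pow n
  have hsub : T ⊆ (Finset.range 41).filter fun k => Y.testBit (64 * k) := fun k hk => by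
    simpa using hT k hk
  have hle := Finset.card_le_card (Finset.filter_subset (fun k => Y.testBit (64 * k) = true)
    (Finset.range 41))
  rw [Finset.card_range] at hle
  calc T.card ≤ _ := Finset.card_le_card hsub
    _ = _ % (2 ^ 64 - 1) := (Nat.mod_eq_of_lt (by omega)).symm
    _ = _ := (key 41).symm

theorem rowMask_row : ∀ k < 41, 0 < k → rowMask / 2 ^ (64 * k) % 2 ^ 64 = 2 ^ 63 - 1 ∧
    rowMask % 2 ^ (64 * k) < 2 ^ (64 * k - 1) := by decide +kernel

theorem card_le_countRows {P : ℕ} {T : Finset ℕ}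
    (hT : ∀ k ∈ T, k < 41 ∧ 0 < k ∧ ∃ b < 63, P.testBit (64 * k + b)) :
    T.card ≤ countRows rowUnits rowMask P := by
  change _ ≤ ((((P &&& rowMask) + rowMask) >>> 63) &&& rowUnits) % (2 ^ 64 - 1)
  refine card_le_mod fun k hk => ⟨(hT k hk).1, ?_⟩
  obtain ⟨hk41, hk0, b, hb, hPb⟩ := hT k hk
  obtain ⟨hM, hM0⟩ := rowMask_row k hk41 hk0
  have htop : ∀ c < 64, rowMask.testBit (64 * k + c) = decide (c < 63) := by
    intro c hc
    have h1 : (rowMask / 2 ^ (64 * k) % 2 ^ 64).testBit c = rowMask.testBit (64 * k + c) := by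
      rw [Nat.testBit_mod_two_pow, Nat.testBit_div_two_pow]; simp [hc, add_comm]
    rw [← h1, hM, Nat.testBit_two_pow_sub_one]
  set A := P &&& rowMask with hA
  have hA0 : A % 2 ^ (64 * k) < 2 ^ (64 * k - 1) := by
    refine lt_of_le_of_lt ?_ hM0
    rw [hA, Nat.and_mod_two_pow]
    exact Nat.and_le_right
  have hAb : (A / 2 ^ (64 * k) % 2 ^ 64).testBit b = true := by
    rw [Nat.testBit_mod_two_pow, Nat.testBit_div_two_pow, hA, Nat.testBit_and, add_comm b, hPb,
      htop b (by omega)]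
    simp [hb]; omega
  have hA63 : A / 2 ^ (64 * k) % 2 ^ 64 < 2 ^ 63 := by
    refine Nat.lt_succ_of_le (n := _) (m := 2 ^ 63 - 1) ?_
    rw [← hM, hA, Nat.and_div_two_pow, Nat.and_mod_two_pow]
    exact Nat.and_le_right
  have hA1 : A / 2 ^ (64 * k) % 2 ^ 64 ≠ 0 := fun h => by
    rw [h, Nat.zero_testBit] at hAb
    exact Bool.false_ne_true hAb
  have hsplit : 2 ^ (64 * k) = 2 * 2 ^ (64 * k - 1) := by
    rw [← pow_succ']; congr 1; omega
  have hdiv : (A + rowMask) / 2 ^ (64 * k) = A / 2 ^ (64 * k) + rowMask / 2 ^ (64 * k) := by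
    rw [Nat.add_div (Nat.two_pow_pos _), if_neg (by omega), add_zero]
  have : (A + rowMask).testBit (64 * k + 63) = true := by
    rw [add_comm (64 * k), ← Nat.testBit_div_two_pow, hdiv, Nat.testBit_eq_decide_div_mod_eq,
      decide_eq_true_eq]
    omega
  rw [Nat.testBit_shiftRight, add_comm 63]
  exact this

theorem diagonal_split : ∀ j < 41,
    diagonal = diagonal % 2 ^ (63 * j) + 2 ^ (63 * j) *
      (1 + 2 ^ 63 * (diagonal / 2 ^ (63 * (j + 1))))
    ∧ (2 ^ 63 - 1) * (diagonal % 2 ^ (63 * j)) < 2 ^ (63 * j) := by decide +kernel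

theorem card_le_countBits {x : ℕ} (hx : x < 2 ^ 63) {T : Finset ℕ}
    (hT : ∀ j ∈ T, j < 41 ∧ x.testBit j) : T.card ≤ countBits rowUnits diagonal x := by
  change _ ≤ ((x * diagonal) &&& rowUnits) % (2 ^ 64 - 1)
  refine card_le_mod fun j hj => ⟨(hT j hj).1, ?_⟩
  obtain ⟨h41, hxj⟩ := hT j hj
  obtain ⟨h1, h2⟩ := diagonal_split j h41
  have hlow : x * (diagonal % 2 ^ (63 * j)) < 2 ^ (63 * j) :=
    lt_of_le_of_lt (Nat.mul_le_mul_right _ (by omega)) h2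
  have hdiv : x * diagonal / 2 ^ (63 * j) =
      x + 2 ^ 63 * (x * (diagonal / 2 ^ (63 * (j + 1)))) := by
    conv_lhs => rw [h1]
    rw [mul_add, mul_left_comm, Nat.add_mul_div_left _ _ (Nat.two_pow_pos _),
      Nat.div_eq_of_lt hlow]
    ring
  rw [show 64 * j = j + 63 * j by ring, ← Nat.testBit_div_two_pow, hdiv, add_comm,
    Nat.testBit_two_pow_mul_add _ hx]
  simp [hxj]; omega

theorem testBit_fold {P q c m : ℕ} (hq : q < 2 * m) (h : P.testBit (64 * (q + 1) + c)) :
    ∃ q' < m, (P ||| P >>> (64 * m)).testBit (64 * (q' + 1) + c) := by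
  rcases lt_or_ge q m with hm | hm
  · exact ⟨q, hm, by simp [h]⟩
  · refine ⟨q - m, by omega, ?_⟩
    rw [Nat.testBit_or, Nat.testBit_shiftRight,
      show 64 * m + (64 * (q - m + 1) + c) = 64 * (q + 1) + c by omega, h, Bool.or_true]

theorem testBit_foldCols {P k c : ℕ} (hk0 : 0 < k) (hk : k < 41) (hc : c < 63)
    (h : P.testBit (64 * k + c)) : (foldCols P).testBit c := by
  simp only [foldCols, force_eq]
  obtain ⟨q, rfl⟩ : ∃ q, k = q + 1 := ⟨k - 1, by omega⟩
  obtain ⟨q, hq, h⟩ := testBit_fold (m := 32) (by omega) h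
  obtain ⟨q, hq, h⟩ := testBit_fold (m := 16) hq h
  obtain ⟨q, hq, h⟩ := testBit_fold (m := 8) hq h
  obtain ⟨q, hq, h⟩ := testBit_fold (m := 4) hq h
  obtain ⟨q, hq, h⟩ := testBit_fold (m := 2) hq h
  obtain ⟨q, hq, h⟩ := testBit_fold (m := 1) hq h
  obtain rfl : q = 0 := by omega
  change (_ >>> 64 &&& (2 ^ 63 - 1)).testBit c = true
  rw [Nat.testBit_and, Nat.testBit_two_pow_sub_one, Nat.testBit_shiftRight, decide_eq_true hc,
    Bool.and_true]
  exact h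

theorem foldCols_lt (P : ℕ) : foldCols P < 2 ^ 63 := by
  simp only [foldCols, force_eq]
  exact Nat.and_lt_two_pow (n := 63) _ (by norm_num)

/-- A set of segments, encoded as numbers, with distinct larger and distinct smaller endpoints. -/
structure IsMatchingCode (s : Finset ℕ) : Prop where
  row_lt : ∀ v ∈ s, v / 64 < 41
  col_lt : ∀ v ∈ s, v % 64 < v / 64
  row_inj : Set.InjOn (· / 64) (s : Set ℕ)
  col_inj : Set.InjOn (· % 64) (s : Set ℕ)

theorem IsMatchingCode.mono {s t : Finset ℕ} (hs : IsMatchingCode s) (h : t ⊆ s) :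
    IsMatchingCode t :=
  ⟨fun v hv => hs.row_lt v (h hv), fun v hv => hs.col_lt v (h hv),
    hs.row_inj.mono (by exact_mod_cast h), hs.col_inj.mono (by exact_mod_cast h)⟩

theorem hasRoom_of_isMatchingCode {s : Finset ℕ} (hs : IsMatchingCode s) {P : ℕ}
    (hP : ∀ v ∈ s, P.testBit v) : hasRoom rowUnits rowMask diagonal s.card P = true := by
  have hP' : ∀ v ∈ s, P.testBit (64 * (v / 64) + v % 64) := fun v hv => by
    rw [Nat.div_add_mod]; exact hP v hv
  have hrows : s.card ≤ countRows rowUnits rowMask P := by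
    rw [← Finset.card_image_of_injOn hs.row_inj]
    refine card_le_countRows fun k hk => ?_
    obtain ⟨v, hv, rfl⟩ := Finset.mem_image.mp hk
    have h1 := hs.row_lt v hv
    have h2 := hs.col_lt v hv
    exact ⟨h1, by omega, v % 64, by omega, hP' v hv⟩
  have hcols : s.card ≤ countBits rowUnits diagonal (foldCols P) := by
    rw [← Finset.card_image_of_injOn hs.col_inj]
    refine card_le_countBits (foldCols_lt P) fun k hk => ?_
    obtain ⟨v, hv, rfl⟩ := Finset.mem_image.mp hk
    have h1 := hs.row_lt v hv
    have h2 := hs.col_lt v hv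
    exact ⟨by omega, testBit_foldCols (by omega) h1 (by omega) (hP' v hv)⟩
  rw [hasRoom, Nat.ble_eq.mpr hrows, Nat.ble_eq.mpr hcols]

/-! ### Correctness of the search -/

theorem boolRec_eq_ite {α : Type} (a b : α) (c : Bool) :
    Bool.rec (motive := fun _ => α) a b c = if c then b else a := by
  cases c <;> rfl

theorem boolRec_false (a c : Bool) : Bool.rec (motive := fun _ => Bool) false a c = (c && a) := by
  cases c <;> rfl

theorem boolRec_true (a c : Bool) : Bool.rec (motive := fun _ => Bool) true a c = (!c || a) := by
  cases c <;> rfl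

namespace Table

theorem buildThen_eq (f : ℕ → ℕ) (d : ℕ) (k : Table → Bool) :
    buildThen f d k = k (build f d 0) := by
  suffices ∀ d i (k : Table → Bool), Nat.rec (motive := fun _ => ℕ → (Table → Bool) → Bool)
      (fun i k => force (f i) fun n => k (leaf n))
      (fun d ih i k => force (Nat.shiftLeft (nat_lit 1) d) fun m => ih i fun l =>
        force (Nat.add i m) fun j => ih j fun r =>
          force (Nat.shiftLeft (nat_lit 1) m) fun m => k (node m l r))
      d i k = k (build f d i) from this d 0 k
  intro d
  induction d with
  | zero => intro i k; exact force_eq _ _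
  | succ d ih =>
    intro i k
    have h (n : ℕ) : Nat.shiftLeft 1 n = 2 ^ n := Nat.one_shiftLeft n
    simp only [force_eq] at ih ⊢
    rw [ih, ih, build, ← h, ← h]
    rfl

theorem all_node (f : ℕ → Bool) (m : ℕ) (l r : Table) (x : ℕ) :
    all f (node m l r) x = if x / m = 0 then all f l x else
      if x % m = 0 then all f r (x / m) else all f r (x / m) && all f l (x % m) := by
  simp only [all, force_eq, boolRec_false]
  simp only [boolRec_eq_ite, Nat.beq_eq]
  rfl

theorem of_all_build {f : ℕ → Bool} {g : ℕ → ℕ} {d i x j : ℕ} (h : all f (build g d i) x)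
    (hj : j < 2 ^ d) (hx : x.testBit j) : f (g (i + j)) := by
  induction d generalizing i x j with
  | zero =>
    obtain rfl : j = 0 := by omega
    exact h
  | succ d ih =>
    rw [build, all_node] at h
    have hlow : j < 2 ^ d → (x % 2 ^ 2 ^ d).testBit j := fun hjd => by
      simp [Nat.testBit_mod_two_pow, hjd, hx]
    have hhigh : ¬ j < 2 ^ d → (x / 2 ^ 2 ^ d).testBit (j - 2 ^ d) := fun hjd => by
      rwa [Nat.testBit_div_two_pow, Nat.sub_add_cancel (by omega)]
    have hji : ¬ j < 2 ^ d → i + 2 ^ d + (j - 2 ^ d) = i + j := by omega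
    rw [pow_succ] at hj
    split_ifs at h with h1 h2
    · by_cases hjd : j < 2 ^ d
      · exact ih h hjd hx
      · simpa [h1] using hhigh hjd
    · by_cases hjd : j < 2 ^ d
      · simpa [h2] using hlow hjd
      · rw [← hji hjd]
        exact ih h (by omega) (hhigh hjd)
    · rw [Bool.and_eq_true] at h
      by_cases hjd : j < 2 ^ d
      · exact ih h.2 hjd (hlow hjd)
      · rw [← hji hjd]
        exact ih h.1 (by omega) (hhigh hjd)

end Table

theorem rowListThen_eq (L n : ℕ) (k : List Row → Bool) :
    rowListThen L n k = k (rowList L n) := by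
  induction n generalizing k with
  | zero => rfl
  | succ n ih =>
    refine (ih _).trans ?_
    rw [Table.buildThen_eq, force_eq]
    rfl

/-- A set of segments, encoded as numbers, that cross according to the table `L`. -/
structure IsCrossingCode (L : ℕ) (s : Finset ℕ) : Prop extends IsMatchingCode s where
  adj : ∀ v ∈ s, ∀ u ∈ s, u / 64 < v / 64 → (adjEntry L (v / 64) (v % 64)).testBit u

theorem IsCrossingCode.mono {L : ℕ} {s t : Finset ℕ} (hs : IsCrossingCode L s) (h : t ⊆ s) :
    IsCrossingCode L t :=
  ⟨hs.toIsMatchingCode.mono h, fun v hv u hu => hs.adj v (h hv) u (h hu)⟩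

theorem search_cons_succ (H M C n r P : ℕ) (t : Table) (rows : List Row) :
    search H M C (⟨n, t⟩ :: rows) (r + 1) P =
      if P >>> n = 0 then search H M C rows (r + 1) P else
        t.all (fun e => !hasRoom H M C r (tag (P &&& e)) || search H M C rows r (tag (P &&& e)))
          (P >>> n) &&
        (!hasRoom H M C (r + 1) (P % 2 ^ n) || search H M C rows (r + 1) (P % 2 ^ n)) := by
  rw [← Nat.one_shiftLeft]
  simp only [search, force_eq, boolRec_false, boolRec_true]
  simp only [boolRec_eq_ite, Nat.beq_eq]
  rfl

theorem not_search {L n P : ℕ} {s : Finset ℕ} (hs : IsCrossingCode L s)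
    (hsn : ∀ v ∈ s, v / 64 < n) (hP : ∀ v ∈ s, P.testBit v) :
    ¬ search rowUnits rowMask diagonal (rowList L n) s.card P := by
  intro h
  induction n generalizing P s with
  | zero =>
    obtain rfl : s = ∅ := Finset.eq_empty_of_forall_notMem fun v hv => by simpa using hsn v hv
    exact Bool.false_ne_true h
  | succ n ih =>
    rcases hr : s.card with - | r
    · rw [hr] at h
      exact Bool.false_ne_true h
    rw [hr, rowList, search_cons_succ] at h
    by_cases hv : ∃ v ∈ s, v / 64 = n
    · obtain ⟨v, hv, rfl⟩ := hv
      have hv64 : v % 64 < 2 ^ 6 := Nat.mod_lt _ (by norm_num)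
      have hx : (P >>> (64 * (v / 64))).testBit (v % 64) := by
        rw [Nat.testBit_shiftRight, Nat.div_add_mod]; exact hP v hv
      rw [if_neg (fun h0 => by simp [h0] at hx), Bool.and_eq_true] at h
      have hall := Table.of_all_build h.1 hv64 hx
      have hsub := Finset.erase_subset v s
      have hcard : (s.erase v).card = r := by rw [Finset.card_erase_of_mem hv, hr]; rfl
      have hlt : ∀ u ∈ s.erase v, u / 64 < v / 64 := fun u hu => by
        have h1 := hsn u (hsub hu)
        have h2 : u / 64 ≠ v / 64 := fun h => Finset.ne_of_mem_erase hu (hs.row_inj (hsub hu) hv h)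
        omega
      have hQ : ∀ u ∈ s.erase v, (tag (P &&& adjEntry L (v / 64) (0 + v % 64))).testBit u :=
        fun u hu => testBit_tag (by
          rw [Nat.testBit_and, hP u (hsub hu), zero_add, hs.adj v hv u (hsub hu) (hlt u hu)]; rfl)
      have hroom := hasRoom_of_isMatchingCode (hs.mono hsub).toIsMatchingCode hQ
      rw [hcard] at hroom
      rw [hroom] at hall
      refine ih (hs.mono hsub) hlt hQ ?_
      rw [hcard]
      simpa using hall
    · push Not at hv
      have hlt : ∀ v ∈ s, v / 64 < n := fun v hvs => by
        have h1 := hsn v hvs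
        have h2 := hv v hvs
        omega
      split_ifs at h with h0
      · exact ih hs hlt hP (by rwa [hr])
      · have hP' : ∀ v ∈ s, (P % 2 ^ (64 * n)).testBit v := fun v hvs => by
          have := hlt v hvs
          rw [Nat.testBit_mod_two_pow, hP v hvs, Bool.and_true, decide_eq_true_eq]
          omega
        have hroom := hasRoom_of_isMatchingCode hs.toIsMatchingCode hP'
        rw [hr] at hroom
        rw [Bool.and_eq_true, hroom] at h
        exact ih hs hlt hP' (by rw [hr]; simpa using h.2)

theorem searchTop_cons_succ (H M C n r m : ℕ) (t : Table) (rows : List Row) :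
    searchTop H M C (⟨n, t⟩ :: rows) r (m + 1) =
      (t.all (fun e => !hasRoom H M C r e || search H M C rows r e) (2 ^ (n / 64) - 1) &&
        searchTop H M C rows r m) := by
  rw [← Nat.one_shiftLeft]
  simp only [searchTop, boolRec_false, boolRec_true]
  rfl

theorem search_of_searchTop {H M C L n r m k l : ℕ}
    (h : searchTop H M C (rowList L n) r m) (hkn : k < n) (hnm : n ≤ k + m) (hk : k < 64)
    (hl : l < k) (hroom : hasRoom H M C r (adjEntry L k l)) :
    search H M C (rowList L k) r (adjEntry L k l) := by
  induction n generalizing m with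
  | zero => omega
  | succ n ih =>
    obtain - | m := m
    · omega
    rw [rowList, searchTop_cons_succ, Bool.and_eq_true] at h
    rcases Nat.lt_succ_iff_lt_or_eq.mp hkn with hkn | rfl
    · exact ih h.2 hkn (by omega)
    · have hall := Table.of_all_build (j := l) h.1 (by omega) (by
        rw [Nat.mul_div_cancel_left _ (by norm_num), Nat.testBit_two_pow_sub_one,
          decide_eq_true hl])
      rw [zero_add, hroom] at hall
      simpa using hall

theorem noFamily_eq (n m : ℕ) :
    noFamily n m = searchTop rowUnits rowMask diagonal (rowList leftTable n) 8 m := by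
  simp only [noFamily, force_eq, rowListThen_eq]

theorem lt_of_noFamily {n m v : ℕ} {s : Finset ℕ} (h : noFamily n m)
    (hs : IsCrossingCode leftTable s) (hcard : s.card = 9) (hv : v ∈ s)
    (hmax : ∀ u ∈ s, u / 64 ≤ v / 64) (hn : v / 64 < n) : v / 64 + m < n := by
  by_contra! hnm
  rw [noFamily_eq] at h
  have hsub := Finset.erase_subset v s
  have hlt : ∀ u ∈ s.erase v, u / 64 < v / 64 := fun u hu =>
    (hmax u (hsub hu)).lt_of_ne fun h =>
      Finset.ne_of_mem_erase hu (hs.row_inj (hsub hu) hv h)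
  have hQ : ∀ u ∈ s.erase v, (adjEntry leftTable (v / 64) (v % 64)).testBit u :=
    fun u hu => hs.adj v hv u (hsub hu) (hlt u hu)
  have hcard' : (s.erase v).card = 8 := by rw [Finset.card_erase_of_mem hv, hcard]
  have hroom := hasRoom_of_isMatchingCode (hs.mono hsub).toIsMatchingCode hQ
  rw [hcard'] at hroom
  have h41 := hs.row_lt v hv
  refine not_search (hs.mono hsub) hlt hQ ?_
  rw [hcard']
  exact search_of_searchTop h hn hnm (by omega) (hs.col_lt v hv) hroom

set_option maxRecDepth 100000 in
theorem noFamily_38_38 : noFamily (nat_lit 38) (nat_lit 38) = true := by decide +kernel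

set_option maxRecDepth 100000 in
theorem noFamily_40_2 : noFamily (nat_lit 40) (nat_lit 2) = true := by decide +kernel

set_option maxRecDepth 100000 in
theorem noFamily_41_1 : noFamily (nat_lit 41) (nat_lit 1) = true := by decide +kernel

theorem not_isCrossingCode {s : Finset ℕ} (hcard : s.card = 9) :
    ¬ IsCrossingCode leftTable s := by
  intro hs
  obtain ⟨v, hv, hmax⟩ := s.exists_max_image (· / 64) (Finset.card_pos.mp (by omega))
  have h41 := lt_of_noFamily (n := 41) (m := 1) noFamily_41_1 hs hcard hv hmax
    (hs.row_lt v hv)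
  have h40 := lt_of_noFamily (n := 40) (m := 2) noFamily_40_2 hs hcard hv hmax
    (by omega)
  have h38 := lt_of_noFamily (n := 38) (m := 38) noFamily_38_38 hs hcard hv hmax
    (by omega)
  omega

/-! ### Correctness of the tables -/

theorem leftMask_cons (p q r : ℕ × ℕ) (l : List (ℕ × ℕ)) :
    leftMask p q (r :: l) = 2 * leftMask p q l + (isLeft p q r).toNat := by
  change Bool.rec (motive := fun _ => ℕ) (2 * leftMask p q l) (2 * leftMask p q l + 1)
    (isLeft p q r) = _
  cases isLeft p q r <;> rfl

theorem testBit_leftMask (p q d : ℕ × ℕ) (l : List (ℕ × ℕ)) {c : ℕ} (hc : c < l.length) :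
    (leftMask p q l).testBit c = isLeft p q (l.getD c d) := by
  induction l generalizing c with
  | nil => simp at hc
  | cons r l ih =>
    rw [leftMask_cons]
    obtain - | c := c
    · cases h : isLeft p q r <;> simp [h]
    · rw [Nat.testBit_succ, show (2 * leftMask p q l + (isLeft p q r).toNat) / 2 = leftMask p q l by
        have := (isLeft p q r).toNat_le; omega, ih (by simpa using hc)]
      simp

theorem leftMask_lt (p q : ℕ × ℕ) (l : List (ℕ × ℕ)) : leftMask p q l < 2 ^ l.length := by
  induction l with
  | nil => exact Nat.one_pos
  | cons r l ih =>
    rw [leftMask_cons, List.length_cons, pow_succ]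
    have := (isLeft p q r).toNat_le
    omega

theorem testBit_getLeft {i j c : ℕ} (hi : i < 41) (hj : j < 41) (hc : c < 41) :
    (getLeft leftTable i j).testBit c = isLeft (point i) (point j) (point c) := by
  have hmask : ∀ i, ∀ j < 41, leftMask (point i) (point j) points < 2 ^ 64 := fun i j _ =>
    (leftMask_lt _ _ _).trans (Nat.pow_lt_pow_right (by norm_num) (by decide))
  have hrow : ∀ i < 41,
      pack 64 (fun j => leftMask (point i) (point j) points) 41 < 2 ^ 4096 := fun i _ =>
    (pack_lt (w := 64) (hmask i)).trans (by gcongr <;> norm_num)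
  change ((leftTable >>> (4096 * i + 64 * j)) &&& (2 ^ 64 - 1)).testBit c = _
  rw [Nat.testBit_and, Nat.testBit_two_pow_sub_one, decide_eq_true (by omega), Bool.and_true,
    Nat.testBit_shiftRight, add_assoc, leftTable]
  refine (testBit_pack hrow hi (by omega)).trans ?_
  refine (testBit_pack (hmask i) hj (by omega)).trans ?_
  exact testBit_leftMask _ _ _ _ hc

theorem adjRow_eq (L k l kl lk a : ℕ) :
    adjRow L k l kl lk a =
      ((getLeft L a k &&& getLeft L l a ||| getLeft L k a &&& getLeft L a l) &&&
        (if kl.testBit a then lk else kl)) &&& (2 ^ a - 1) := by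
  rw [← boolRec_eq_ite, ← Nat.one_shiftLeft]
  rfl

theorem testBit_adjEntry {k l a b : ℕ} (hba : b < a) (hak : a < k) (hk : k < 41) (hlk : l < k)
    (h : isLeft (point a) (point k) (point b) ∧ isLeft (point l) (point a) (point b) ∨
      isLeft (point k) (point a) (point b) ∧ isLeft (point a) (point l) (point b))
    (h' : if isLeft (point k) (point l) (point a) then isLeft (point l) (point k) (point b) else
      isLeft (point k) (point l) (point b)) :
    (adjEntry leftTable k l).testBit (64 * a + b) := by
  rw [adjEntry, Nat.ble_eq.mpr hlk]
  simp only [force_eq]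
  refine testBit_tag (testBit_pack_of_lt hak ?_)
  rw [adjRow_eq, Nat.testBit_and, Nat.testBit_and, Nat.testBit_or, Nat.testBit_and, Nat.testBit_and,
    Nat.testBit_two_pow_sub_one, apply_ite (Nat.testBit · b)]
  simp only [testBit_getLeft, hak.trans hk, (hba.trans hak).trans hk, hk, hlk.trans hk]
  simp [hba, h]
  split_ifs at h' ⊢ <;> exact h'

/-! ### Geometry of crossing segments -/

/-- Twice the signed area of the triangle `p q r`. -/
def det (p q r : ℝ × ℝ) : ℝ := (q.1 - p.1) * (r.2 - p.2) - (q.2 - p.2) * (r.1 - p.1)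

theorem det_eq_zero_of_collinear {p q r : ℝ × ℝ} (h : Collinear ℝ ({p, q, r} : Set (ℝ × ℝ))) :
    det p q r = 0 := by
  obtain ⟨v, hv⟩ := (collinear_iff_of_mem (p₀ := p) (by simp)).mp h
  obtain ⟨a, rfl⟩ := hv q (by simp)
  obtain ⟨b, rfl⟩ := hv r (by simp)
  simp only [det, vadd_eq_add, Prod.fst_add, Prod.snd_add, Prod.smul_fst, Prod.smul_snd,
    smul_eq_mul]
  ring

theorem _root_.Crosses.symm {p q r s : ℝ × ℝ} (h : Crosses p q r s) : Crosses r s p q := by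
  obtain ⟨x, h1, h2, h3⟩ := h
  exact ⟨x, h2, h1, by rwa [Set.inter_comm]⟩

theorem _root_.Crosses.swap_left {p q r s : ℝ × ℝ} (h : Crosses p q r s) : Crosses q p r s := by
  obtain ⟨x, h1, h2, h3⟩ := h
  exact ⟨x, by rwa [openSegment_symm], h2, by rwa [segment_symm]⟩

theorem _root_.Crosses.swap_right {p q r s : ℝ × ℝ} (h : Crosses p q r s) : Crosses p q s r :=
  h.symm.swap_left.symm

/-- The endpoints of a segment that crosses `p q` are on different sides of the line `p q`, or
both on it. -/
theorem _root_.Crosses.det_combination {p q r s : ℝ × ℝ} (h : Crosses p q r s) :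
    ∃ a b : ℝ, 0 < a ∧ 0 < b ∧ a * det p q r + b * det p q s = 0 := by
  obtain ⟨x, ⟨c, d, -, -, hcd, rfl⟩, ⟨a, b, ha, hb, hab, hx⟩, -⟩ := h
  refine ⟨a, b, ha, hb, ?_⟩
  obtain rfl : c = 1 - d := by linarith
  obtain rfl : a = 1 - b := by linarith
  simp only [Prod.ext_iff, Prod.fst_add, Prod.snd_add, Prod.smul_fst, Prod.smul_snd,
    smul_eq_mul] at hx
  simp only [det]
  linear_combination (q.1 - p.1) * hx.2 - (q.2 - p.2) * hx.1

theorem _root_.Crosses.left_ne {p q r s : ℝ × ℝ} (h : Crosses p q r s) (hrs : r ≠ s) : p ≠ r := by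
  rintro rfl
  obtain ⟨x, -, h2, h3⟩ := h
  have hp : p ∈ ({x} : Set (ℝ × ℝ)) :=
    h3 ▸ ⟨left_mem_segment ℝ p q, left_mem_segment ℝ p s⟩
  obtain rfl := hp
  exact hrs ((left_mem_openSegment_iff).mp h2)

theorem _root_.Crosses.det_mul_det_neg {p q r s : ℝ × ℝ} (h : Crosses p q r s)
    (h0 : det p q r ≠ 0) : det p q r * det p q s < 0 := by
  obtain ⟨a, b, ha, hb, hab⟩ := h.det_combination
  have hs : det p q s = -(a / b * det p q r) := by field_simp; linarith
  have : 0 < a / b * (det p q r * det p q r) :=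
    mul_pos (div_pos ha hb) (mul_self_pos.mpr h0)
  rw [hs]
  linarith

/-! ### The point set in the plane -/

/-- The `i`-th point in the real plane. -/
noncomputable def realPoint (i : ℕ) : ℝ × ℝ := ((point i).1, (point i).2)

theorem isLeft_iff (i j k : ℕ) : isLeft (point i) (point j) (point k) ↔
    0 < det (realPoint i) (realPoint j) (realPoint k) := by
  have h : det (realPoint i) (realPoint j) (realPoint k) =
      (((point i).1 * (point j).2 + (point j).1 * (point k).2 + (point k).1 * (point i).2 : ℕ) : ℝ) -
      ((point i).2 * (point j).1 + (point j).2 * (point k).1 + (point k).2 * (point i).1 : ℕ) := by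
    simp only [det, realPoint]
    push_cast
    ring
  rw [h, sub_pos, Nat.cast_lt]
  exact iff_of_eq Nat.ble_eq

theorem det_swap (p q r : ℝ × ℝ) : det q p r = -det p q r := by
  simp only [det]; ring

theorem det_rotate (p q r : ℝ × ℝ) : det q r p = det p q r := by
  simp only [det]; ring

theorem isLeft_or_isLeft : ∀ i < 41, ∀ j < i, ∀ k < j,
    isLeft (point i) (point j) (point k) || isLeft (point j) (point i) (point k) := by
  decide +kernel

theorem det_realPoint_ne_zero {i j k : ℕ} (hi : i < 41) (hj : j < 41) (hk : k < 41) (hij : i ≠ j)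
    (hik : i ≠ k) (hjk : j ≠ k) : det (realPoint i) (realPoint j) (realPoint k) ≠ 0 := by
  have key : ∀ i < 41, ∀ j < i, ∀ k < j,
      det (realPoint i) (realPoint j) (realPoint k) ≠ 0 := by
    intro i hi j hj k hk h0
    have h := isLeft_or_isLeft i hi j hj k hk
    rw [Bool.or_eq_true, isLeft_iff, isLeft_iff, det_swap (realPoint i), h0] at h
    simp at h
  intro h
  have hjki := (det_rotate _ _ _).trans h
  have hkij := (det_rotate _ _ _).trans hjki
  have hjik := (det_swap _ _ _).trans (neg_eq_zero.mpr h)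
  have hikj := (det_rotate _ _ _).trans hjik
  have hkji := (det_rotate _ _ _).trans hikj
  rcases lt_or_gt_of_ne hij with h1 | h1 <;> rcases lt_or_gt_of_ne hik with h2 | h2 <;>
    rcases lt_or_gt_of_ne hjk with h3 | h3
  · exact key k hk j h3 i h1 hkji
  · exact key j hj k h3 i h2 hjki
  · omega
  · exact key j hj i h1 k h2 hjik
  · exact key k hk i h2 j h1 hkij
  · omega
  · exact key i hi k h2 j h3 hikj
  · exact key i hi j h1 k h3 h

theorem realPoint_injOn : Set.InjOn realPoint (Finset.range 41 : Set ℕ) := by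
  intro i hi j hj hij
  by_contra hne
  obtain ⟨k, hk, hki, hkj⟩ : ∃ k < 41, i ≠ k ∧ j ≠ k := by
    by_contra! hall
    have h0 := hall 0
    have h1 := hall 1
    have h2 := hall 2
    omega
  refine det_realPoint_ne_zero (by simpa using hi) (by simpa using hj) hk hne hki hkj ?_
  rw [hij]
  simp [det]

/-- The forty-one points in the plane. -/
noncomputable def pointSet : Finset (ℝ × ℝ) := (Finset.range 41).image realPoint

theorem mem_pointSet {p : ℝ × ℝ} : p ∈ pointSet ↔ ∃ i < 41, realPoint i = p := by
  simp [pointSet]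

theorem card_pointSet : pointSet.card = 41 := by
  rw [pointSet, Finset.card_image_of_injOn realPoint_injOn, Finset.card_range]

theorem genPos_pointSet : GenPos pointSet := by
  intro p hp q hq r hr hpq hpr hqr h
  obtain ⟨i, hi, rfl⟩ := mem_pointSet.mp hp
  obtain ⟨j, hj, rfl⟩ := mem_pointSet.mp hq
  obtain ⟨k, hk, rfl⟩ := mem_pointSet.mp hr
  exact det_realPoint_ne_zero hi hj hk (ne_of_apply_ne _ hpq) (ne_of_apply_ne _ hpr)
    (ne_of_apply_ne _ hqr) (det_eq_zero_of_collinear h)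

theorem isLeft_of_crosses {k l a b : ℕ} (hk : k < 41) (hl : l < 41) (ha : a < 41)
    (hkl : k ≠ l) (hka : k ≠ a) (hla : l ≠ a)
    (h : Crosses (realPoint k) (realPoint l) (realPoint a) (realPoint b)) :
    isLeft (point k) (point l) (point a) ∧ isLeft (point l) (point k) (point b) ∨
      isLeft (point l) (point k) (point a) ∧ isLeft (point k) (point l) (point b) := by
  have h := h.det_mul_det_neg (det_realPoint_ne_zero hk hl ha hkl hka hla)
  simp only [isLeft_iff, det_swap (realPoint k) (realPoint l), neg_pos]
  exact mul_neg_iff.mp h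

theorem isLeft_rotate (i j k : ℕ) :
    isLeft (point j) (point k) (point i) = isLeft (point i) (point j) (point k) := by
  rw [Bool.eq_iff_iff, isLeft_iff, isLeft_iff, det_rotate]

theorem isLeft_asymm {i j k : ℕ} (h : isLeft (point i) (point j) (point k)) :
    ¬ isLeft (point j) (point i) (point k) := by
  rw [isLeft_iff] at h ⊢
  rw [det_swap]
  linarith

theorem testBit_adjEntry_of_crosses {k l a b : ℕ} (hba : b < a) (hak : a < k) (hk : k < 41)
    (hlk : l < k) (hla : l ≠ a)
    (h : Crosses (realPoint k) (realPoint l) (realPoint a) (realPoint b)) :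
    (adjEntry leftTable k l).testBit (64 * a + b) := by
  have h1 := isLeft_of_crosses hk (hlk.trans hk) (hak.trans hk) hlk.ne' hak.ne' hla h
  have h2 := isLeft_of_crosses (hak.trans hk) (hba.trans (hak.trans hk)) hk hba.ne' hak.ne
    (hba.trans hak).ne h.symm
  refine testBit_adjEntry hba hak hk hlk ?_ ?_
  · rw [isLeft_rotate b a k, isLeft_rotate b l a, isLeft_rotate a b l, isLeft_rotate b k a,
      isLeft_rotate a b k, isLeft_rotate b a l]
    exact h2.symm
  · rcases h1 with ⟨h1, h1'⟩ | ⟨h1, h1'⟩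
    · rw [if_pos h1]; exact h1'
    · rw [if_neg (isLeft_asymm h1)]; exact h1'

theorem exists_segmentCode {F : Finset ((ℝ × ℝ) × (ℝ × ℝ))} (hF : IsCrossingFamily pointSet F) :
    ∃ k l : (ℝ × ℝ) × (ℝ × ℝ) → ℕ, (∀ e ∈ F, k e < 41 ∧ l e < k e) ∧
      ∀ e ∈ F, ∀ f ∈ F, e ≠ f →
        Crosses (realPoint (k e)) (realPoint (l e)) (realPoint (k f)) (realPoint (l f)) := by
  have hcode : ∀ e ∈ F, ∃ k l : ℕ, (k < 41 ∧ l < k) ∧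
      (e = (realPoint k, realPoint l) ∨ e = (realPoint l, realPoint k)) := by
    rintro ⟨p, q⟩ he
    obtain ⟨hp, hq, hpq⟩ := hF.1 _ he
    obtain ⟨i, hi, rfl⟩ := mem_pointSet.mp hp
    obtain ⟨j, hj, rfl⟩ := mem_pointSet.mp hq
    rcases lt_or_gt_of_ne (ne_of_apply_ne realPoint hpq) with h | h
    · exact ⟨j, i, ⟨hj, h⟩, Or.inr rfl⟩
    · exact ⟨i, j, ⟨hi, h⟩, Or.inl rfl⟩
  choose! k l hkl hcode using hcode
  refine ⟨k, l, hkl, fun e he f hf hne => ?_⟩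
  have h := hF.2 e he f hf hne
  have hl : Crosses (realPoint (k e)) (realPoint (l e)) f.1 f.2 := by
    rcases hcode e he with h' | h' <;> rw [h'] at h
    exacts [h, h.swap_left]
  rcases hcode f hf with h' | h' <;> rw [h'] at hl
  exacts [hl, hl.swap_right]

theorem not_hasCrossingFamily_pointSet : ¬ HasCrossingFamily pointSet 9 := by
  rintro ⟨F, hF, hcard⟩
  obtain ⟨k, l, hkl, hcross⟩ := exists_segmentCode hF
  have hinj : ∀ i < 41, ∀ j < 41, realPoint i = realPoint j → i = j := fun i hi j hj h =>
    realPoint_injOn (by simpa using hi) (by simpa using hj) h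
  have hne : ∀ e ∈ F, ∀ f ∈ F, e ≠ f → k e ≠ k f ∧ l e ≠ l f ∧ l e ≠ k f := by
    intro e he f hf hef
    have h := hcross e he f hf hef
    have hfk := hkl f hf
    have hf' : realPoint (k f) ≠ realPoint (l f) := fun h0 => by
      have := hinj _ hfk.1 _ (hfk.2.trans hfk.1) h0
      omega
    exact ⟨ne_of_apply_ne _ (h.left_ne hf'),
      ne_of_apply_ne _ (h.swap_left.swap_right.left_ne hf'.symm),
      ne_of_apply_ne _ (h.swap_left.left_ne hf')⟩
  have hdiv : ∀ e ∈ F, (64 * k e + l e) / 64 = k e := fun e he => by have := hkl e he; omega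
  have hmod : ∀ e ∈ F, (64 * k e + l e) % 64 = l e := fun e he => by have := hkl e he; omega
  have hcode : Set.InjOn (fun e => 64 * k e + l e) (F : Set ((ℝ × ℝ) × (ℝ × ℝ))) := by
    intro e he f hf hef
    by_contra h
    refine (hne e he f hf h).1 ?_
    rw [← hdiv e he, ← hdiv f hf, show 64 * k e + l e = 64 * k f + l f from hef]
  have hcard' : (F.image fun e => 64 * k e + l e).card = 9 := by
    rw [Finset.card_image_of_injOn hcode, hcard]
  refine not_isCrossingCode hcard' ⟨⟨?_, ?_, ?_, ?_⟩, ?_⟩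
  · simp only [Finset.forall_mem_image]
    exact fun e he => (hdiv e he).trans_lt (hkl e he).1
  · simp only [Finset.forall_mem_image]
    exact fun e he => by rw [hdiv e he, hmod e he]; exact (hkl e he).2
  · simp only [Set.InjOn, Finset.mem_coe, Finset.forall_mem_image]
    intro e he f hf h
    rw [hdiv e he, hdiv f hf] at h
    by_contra h'
    exact (hne e he f hf fun hef => h' (by rw [hef])).1 h
  · simp only [Set.InjOn, Finset.mem_coe, Finset.forall_mem_image]
    intro e he f hf h
    rw [hmod e he, hmod f hf] at h
    by_contra h'
    exact (hne e he f hf fun hef => h' (by rw [hef])).2.1 h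
  · simp only [Finset.forall_mem_image]
    intro e he f hf h
    rw [hdiv e he, hdiv f hf] at h
    rw [hdiv e he, hmod e he]
    have hef : e ≠ f := by rintro rfl; exact lt_irrefl _ h
    obtain ⟨-, -, h3⟩ := hne e he f hf hef
    exact testBit_adjEntry_of_crosses (hkl f hf).2 h (hkl e he).1 (hkl e he).2 h3
      (hcross e he f hf hef)

end CrossingSearch

/-- There exists a set of 41 points in the plane in general position that
contains no 9-crossing family. -/
theorem exists_41_points_without_9_crossing_family :
    ∃ S : Finset (ℝ × ℝ), S.card = 41 ∧ GenPos S ∧ ¬ HasCrossingFamily S 9 := by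
  exact ⟨CrossingSearch.pointSet, CrossingSearch.card_pointSet, CrossingSearch.genPos_pointSet,
    CrossingSearch.not_hasCrossingFamily_pointSet⟩
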